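/- Let Ω ⊂ ℝᴺ be a bounded open set. Let M : ℝᴺ → ℝᴺ be a monotone operator (⟨M(p) − M(q), p − q⟩ ≥ 0 for all p, q), differentiable at every p ≠ 0 with M(p) ≠ 0 for p ≠ 0, and suppose there is a continuous map G from ℝᴺ to the N×N matrices such that G(p) = (‖p‖³/‖M(p)‖)·DM(p) for every p ≠ 0, where DM(p) is the derivative (Jacobian matrix) of M at p. Let u : Ω → ℝ be Lipschitz and a weak solution of div(M(∇u)) = 0 in Ω, i.e. ∫_Ω ⟨M(∇u(x)), ∇φ(x)⟩ dx = 0 for every smooth φ with compact support contained in Ω (∇u being the a.e.-defined Rademacher gradient). Then u is a viscosity solution in Ω of −tr(G(∇u)·∇²u) = 0. -/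

import Mathlib

open Set MeasureTheory Metric Filter
open scoped RealInnerProductSpace Topology Classical

noncomputable section

abbrev EN (N : ℕ) := EuclideanSpace ℝ (Fin N)

/-- A function is Lipschitz on a set (with some constant). -/
def LipOn {N : ℕ} (w : EN N → ℝ) (s : Set (EN N)) : Prop := ∃ L : NNReal, LipschitzOnWith L w s

/-- The functional `J(w) = ∫_Ω f(‖∇w‖)`, with `∇w` the a.e.-defined (Rademacher) gradient. -/
def J {N : ℕ} (f : ℝ → ℝ) (Ω : Set (EN N)) (w : EN N → ℝ) : ℝ := ∫ x in Ω, f ‖gradient w x‖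

/-- The (one-sided at `0`) derivative of `f` on `[0,∞)`. -/
def dtop (f : ℝ → ℝ) : ℝ → ℝ := derivWithin f (Set.Ici 0)

/-- Standing assumptions on the Lagrangian `f`. -/
def StdF (f : ℝ → ℝ) : Prop :=
  StrictConvexOn ℝ (Set.Ici 0) f ∧ ContDiffOn ℝ 1 f (Set.Ici 0) ∧
  ContDiffOn ℝ 2 f (Set.Ioi 0) ∧
  (∃ lam : NNReal, 0 < lam ∧ lam < 1 ∧ ∀ K : Set ℝ, IsCompact K → K ⊆ Set.Ioi 0 →
    ∃ C : NNReal, HolderOnWith C lam (deriv (dtop f)) K) ∧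
  0 < dtop f 0

/-- `u` solves the variational problem (P) for the Lagrangian `f`. -/
def SolvesP {N : ℕ} (f : ℝ → ℝ) (Ω : Set (EN N)) (ψ u : EN N → ℝ) : Prop :=
  LipOn u (closure Ω) ∧ EqOn u ψ (frontier Ω) ∧
  ∀ w : EN N → ℝ, LipOn w (closure Ω) → EqOn w ψ (frontier Ω) → J f Ω u ≤ J f Ω w

/-- `(Ω, ψ)` satisfies the bounded slope condition with constant `Q`. -/
def BSC {N : ℕ} (Ω : Set (EN N)) (ψ : EN N → ℝ) (Q : ℝ) : Prop :=
  ∀ x₀ ∈ frontier Ω, ∃ a b : EN N, ∃ c d : ℝ,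
    ‖a‖ ≤ Q ∧ ‖b‖ ≤ Q ∧
    (∀ x ∈ frontier Ω, ⟪a, x⟫ + c ≤ ψ x ∧ ψ x ≤ ⟪b, x⟫ + d) ∧
    ⟪a, x₀⟫ + c = ψ x₀ ∧ ⟪b, x₀⟫ + d = ψ x₀

/-- `w` is a viscosity solution of `F(∇w, ∇²w) = 0` in `Ω`: `w` is continuous on `Ω` and, for
every `C²` test function `φ` such that `w − φ` has a local maximum (resp. minimum) on `Ω` at
`x`, one has `F(∇φ(x), ∇²φ(x)) ≤ 0` (resp. `≥ 0`). The Hessian is encoded as the operator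
`fderiv ℝ (gradient φ) x`. -/
def ViscositySol {N : ℕ} (Ω : Set (EN N)) (F : EN N → (EN N →L[ℝ] EN N) → ℝ)
    (w : EN N → ℝ) : Prop :=
  ContinuousOn w Ω ∧
  (∀ x ∈ Ω, ∀ φ : EN N → ℝ, ContDiff ℝ 2 φ →
    IsLocalMaxOn (fun y => w y - φ y) Ω x →
    F (gradient φ x) (fderiv ℝ (gradient φ) x) ≤ 0) ∧
  (∀ x ∈ Ω, ∀ φ : EN N → ℝ, ContDiff ℝ 2 φ →
    IsLocalMinOn (fun y => w y - φ y) Ω x →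
    0 ≤ F (gradient φ x) (fderiv ℝ (gradient φ) x))

section Mollification

open scoped Convolution

lemma hasFDerivAt_convolution_of_lipschitzWith {N : ℕ} {ρ ψ : EN N → ℝ} {K : NNReal}
    (hρ : Continuous ρ) (hρs : HasCompactSupport ρ) (hψ : LipschitzWith K ψ) (x : EN N) :
    HasFDerivAt (ρ ⋆[ContinuousLinearMap.lsmul ℝ ℝ, volume] ψ)
      ((ρ ⋆[ContinuousLinearMap.lsmul ℝ ℝ, volume] fderiv ℝ ψ) x) x := by
  have hae : ∀ᵐ t : EN N, DifferentiableAt ℝ ψ (x - t) :=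
    (quasiMeasurePreserving_sub_left volume x).ae hψ.ae_differentiableAt
  have hint : ∀ y, Continuous fun t => ρ t • ψ (y - t) := fun y =>
    hρ.smul (hψ.continuous.comp (continuous_const.sub continuous_id))
  refine (hasFDerivAt_integral_of_dominated_loc_of_lip (𝕜 := ℝ) (s := univ)
    (F := fun y t => ρ t • ψ (y - t)) (bound := fun t => |ρ t| * K)
    (F' := fun t => ρ t • fderiv ℝ ψ (x - t)) univ_mem ?_ ?_ ?_ ?_ ?_ ?_).2
  · exact .of_forall fun y => (hint y).aestronglyMeasurable
  · exact (hint x).integrable_of_hasCompactSupport hρs.smul_right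
  · refine hρ.aestronglyMeasurable.smul ?_
    exact ((measurable_fderiv ℝ ψ).comp (measurable_const.sub measurable_id)).aestronglyMeasurable
  · refine .of_forall fun t => LipschitzOnWith.of_dist_le_mul fun y _ z _ => ?_
    rw [Real.coe_nnabs, abs_of_nonneg (by positivity), mul_assoc, Real.dist_eq, ← smul_sub,
      smul_eq_mul, abs_mul]
    gcongr
    simpa [Real.dist_eq] using hψ.dist_le_mul (y - t) (z - t)
  · exact ((hρ.abs.integrable_of_hasCompactSupport hρs.abs)).mul_const _
  · filter_upwards [hae] with t ht
    exact ((hasFDerivAt_comp_sub t).2 ht.hasFDerivAt).const_smul (ρ t)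

/-- An `L^∞` field that is weakly divergence free against smooth test functions
is so against Lipschitz test functions. -/
lemma setIntegral_fderiv_lipschitz_eq_zero {N : ℕ} {Ω : Set (EN N)} (hΩo : IsOpen Ω)
    (hΩb : Bornology.IsBounded Ω) {W : EN N → EN N} {C : ℝ}
    (hWm : AEStronglyMeasurable W (volume.restrict Ω)) (hWb : ∀ x ∈ Ω, ‖W x‖ ≤ C)
    (hweak : ∀ φ : EN N → ℝ, ContDiff ℝ (⊤ : ℕ∞) φ → HasCompactSupport φ → tsupport φ ⊆ Ω →
      (∫ x in Ω, fderiv ℝ φ x (W x)) = 0)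
    {ψ : EN N → ℝ} {K : NNReal} (hψ : LipschitzWith K ψ) (hψc : HasCompactSupport ψ)
    (hψΩ : tsupport ψ ⊆ Ω) :
    (∫ x in Ω, fderiv ℝ ψ x (W x)) = 0 := by
  let b : ℕ → ContDiffBump (0 : EN N) := fun n =>
    ⟨1 / ((n : ℝ) + 1), 2 * (1 / ((n : ℝ) + 1)), by positivity,
      lt_mul_of_one_lt_left (by positivity) one_lt_two⟩
  have hb : Tendsto (fun n => (b n).rOut) atTop (𝓝 0) := by
    have h := (tendsto_one_div_add_atTop_nhds_zero_nat (𝕜 := ℝ)).const_mul 2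
    rwa [mul_zero] at h
  let ψn : ℕ → EN N → ℝ := fun n =>
    (b n).normed volume ⋆[ContinuousLinearMap.lsmul ℝ ℝ, volume] ψ
  have hder : ∀ n x, HasFDerivAt (ψn n) (((b n).normed volume
      ⋆[ContinuousLinearMap.lsmul ℝ ℝ, volume] fderiv ℝ ψ) x) x := fun n x =>
    hasFDerivAt_convolution_of_lipschitzWith (b n).continuous_normed
      (b n).hasCompactSupport_normed hψ x
  have hLip : ∀ n x, ‖fderiv ℝ (ψn n) x‖ ≤ K := by
    intro n x
    rw [(hder n x).fderiv]
    have h1 : Integrable (fun t => (b n).normed volume t * (K : ℝ)) :=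
      (b n).integrable_normed.mul_const _
    refine (norm_integral_le_of_norm_le h1 (.of_forall fun t => ?_)).trans ?_
    · rw [ContinuousLinearMap.lsmul_apply, norm_smul, Real.norm_of_nonneg ((b n).nonneg_normed t)]
      exact mul_le_mul_of_nonneg_left (norm_fderiv_le_of_lipschitz ℝ hψ) ((b n).nonneg_normed t)
    · rw [integral_mul_const, (b n).integral_normed, one_mul]
  have hlocint : LocallyIntegrable (fderiv ℝ ψ) (volume : Measure (EN N)) := by
    refine (locallyIntegrable_const (K : ℝ)).mono
      (measurable_fderiv ℝ ψ).aestronglyMeasurable (.of_forall fun x => ?_)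
    simpa using norm_fderiv_le_of_lipschitz ℝ hψ
  have hconv : ∀ᵐ x : EN N, Tendsto (fun n => fderiv ℝ (ψn n) x) atTop (𝓝 (fderiv ℝ ψ x)) := by
    filter_upwards [ContDiffBump.ae_convolution_tendsto_right_of_locallyIntegrable (K := 2) hb
      (.of_forall fun n => le_rfl) hlocint] with x hx
    simpa only [(hder _ x).fderiv] using hx
  obtain ⟨δ, hδ, hδΩ⟩ := hψc.isCompact.exists_cthickening_subset_open hΩo hψΩ
  have hzero : ∀ᶠ n in atTop, (∫ x in Ω, fderiv ℝ (ψn n) x (W x)) = 0 := by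
    filter_upwards [hb.eventually (gt_mem_nhds hδ)] with n hn
    refine hweak _ ?_ ?_ ?_
    · exact (b n).hasCompactSupport_normed.contDiff_convolution_left _ (b n).contDiff_normed
        hψ.continuous.locallyIntegrable
    · exact (b n).hasCompactSupport_normed.convolution _ hψc
    · refine subset_trans (closure_minimal ?_ isClosed_cthickening) hδΩ
      refine (support_convolution_subset_swap _).trans ?_
      rintro _ ⟨y, hy, z, hz, rfl⟩
      rw [(b n).support_normed_eq, mem_ball_zero_iff] at hz
      refine mem_cthickening_of_dist_le _ y δ _ (subset_tsupport _ hy) ?_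
      simpa [dist_eq_norm] using (hz.trans hn).le
  have hfin : IsFiniteMeasure ((volume : Measure (EN N)).restrict Ω) :=
    isFiniteMeasure_restrict.2 hΩb.measure_lt_top.ne
  have hlim : Tendsto (fun n => ∫ x in Ω, fderiv ℝ (ψn n) x (W x)) atTop
      (𝓝 (∫ x in Ω, fderiv ℝ ψ x (W x))) := by
    refine tendsto_integral_of_dominated_convergence (fun _ => K * C) (fun n => ?_)
      (integrable_const _) (fun n => ?_) ?_
    · exact (ContinuousLinearMap.id ℝ (EN N →L[ℝ] ℝ)).aestronglyMeasurable_comp₂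
        (measurable_fderiv ℝ _).aestronglyMeasurable hWm
    · filter_upwards [ae_restrict_mem hΩo.measurableSet] with x hx
      exact (ContinuousLinearMap.le_opNorm _ _).trans
        (mul_le_mul (hLip n x) (hWb x hx) (norm_nonneg _) K.coe_nonneg)
    · filter_upwards [ae_restrict_of_ae hconv] with x hx
      exact ((ContinuousLinearMap.apply ℝ ℝ (W x)).continuous.tendsto _).comp hx
  exact tendsto_nhds_unique hlim (tendsto_const_nhds.congr' (hzero.mono fun _ h => h.symm))

end Mollification

section Regularity

variable {N : ℕ} {M : EN N → EN N} {G : EN N → (EN N →L[ℝ] EN N)}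

lemma norm_le_of_monotone (hmono : ∀ p q : EN N, 0 ≤ ⟪M p - M q, p - q⟫) {p q : EN N} {c : ℝ}
    (hc : c * ‖M p‖ ≤ ⟪M p, q⟫) : (c - ‖p‖) * ‖M p‖ ≤ ‖M q‖ * (‖q‖ + ‖p‖) := by
  have h1 := hmono p q
  simp only [inner_sub_left, inner_sub_right] at h1
  have h2 : ⟪M p, p⟫ ≤ ‖M p‖ * ‖p‖ := real_inner_le_norm _ _
  have h3 : ⟪M q, q⟫ ≤ ‖M q‖ * ‖q‖ := real_inner_le_norm _ _
  have h4 : -⟪M q, p⟫ ≤ ‖M q‖ * ‖p‖ := (neg_le_abs _).trans (abs_real_inner_le_norm _ _)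
  linarith

lemma inner_inv_norm_smul_self (m : EN N) : ⟪m, ‖m‖⁻¹ • m⟫ = ‖m‖ := by
  rw [real_inner_smul_right, real_inner_self_eq_norm_sq]
  rcases eq_or_ne ‖m‖ 0 with h | h
  · simp [h]
  · field_simp

lemma norm_inv_norm_smul_self_le (m : EN N) : ‖‖m‖⁻¹ • m‖ ≤ 1 := by
  rw [norm_smul, norm_inv, norm_norm]
  exact inv_mul_le_one

/-- A monotone operator that is differentiable away from the origin is locally bounded. -/
lemma exists_norm_le_of_monotone (hmono : ∀ p q : EN N, 0 ≤ ⟪M p - M q, p - q⟫)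
    (hMdiff : ∀ p : EN N, p ≠ 0 → DifferentiableAt ℝ M p) (L : ℝ) :
    ∃ B : ℝ, 0 ≤ B ∧ ∀ p, ‖p‖ ≤ L → ‖M p‖ ≤ B := by
  have hcont : ContinuousOn M (sphere 0 (|L| + 1)) := fun p hp =>
    (hMdiff p (ne_zero_of_mem_sphere (by positivity) ⟨p, hp⟩)).continuousAt.continuousWithinAt
  obtain ⟨C, hC⟩ := (isCompact_sphere (0 : EN N) (|L| + 1)).exists_bound_of_continuousOn hcont
  refine ⟨max C 0 * (2 * |L| + 1), by positivity, fun p hp => ?_⟩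
  rcases eq_or_ne (M p) 0 with h0 | h0
  · rw [h0, norm_zero]; positivity
  set q : EN N := (|L| + 1) • ‖M p‖⁻¹ • M p with hq
  have hqn : ‖q‖ = |L| + 1 := by
    rw [hq, norm_smul, norm_smul, norm_inv, norm_norm, inv_mul_cancel₀ (norm_ne_zero_iff.2 h0),
      mul_one, Real.norm_of_nonneg (by positivity)]
  have h1 : (|L| + 1 - ‖p‖) * ‖M p‖ ≤ ‖M q‖ * (‖q‖ + ‖p‖) := by
    refine norm_le_of_monotone hmono ?_
    rw [hq, real_inner_smul_right, inner_inv_norm_smul_self]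
  have h2 : ‖p‖ ≤ |L| := hp.trans (le_abs_self L)
  calc ‖M p‖ ≤ (|L| + 1 - ‖p‖) * ‖M p‖ := le_mul_of_one_le_left (norm_nonneg _) (by linarith)
    _ ≤ ‖M q‖ * (‖q‖ + ‖p‖) := h1
    _ ≤ max C 0 * (2 * |L| + 1) :=
      mul_le_mul ((hC q (by simp [hqn])).trans (le_max_left _ _)) (by linarith) (by positivity)
        (by positivity)

lemma fderiv_eq_smul_of_normalized (hMne : ∀ p : EN N, p ≠ 0 → M p ≠ 0)
    (hG : ∀ p : EN N, p ≠ 0 → G p = (‖p‖ ^ 3 / ‖M p‖) • fderiv ℝ M p) {p : EN N} (hp : p ≠ 0) :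
    fderiv ℝ M p = (‖M p‖ / ‖p‖ ^ 3) • G p := by
  have h1 := norm_ne_zero_iff.2 hp
  have h2 := norm_ne_zero_iff.2 (hMne p hp)
  rw [hG p hp, smul_smul, show ‖M p‖ / ‖p‖ ^ 3 * (‖p‖ ^ 3 / ‖M p‖) = 1 by field_simp, one_smul]

lemma exists_norm_le_on_segment (hMdiff : ∀ p : EN N, p ≠ 0 → DifferentiableAt ℝ M p)
    (hMne : ∀ p : EN N, p ≠ 0 → M p ≠ 0)
    (hG : ∀ p : EN N, p ≠ 0 → G p = (‖p‖ ^ 3 / ‖M p‖) • fderiv ℝ M p)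
    {v : EN N} {c s K : ℝ} (hc : 0 < c) (hs : 0 < s)
    (hv : ∀ t ∈ Ioo s (2 * s), c ≤ |⟪G (t • v) v, v⟫|)
    (hK : ∀ t ∈ Icc s (2 * s), ‖M (t • v)‖ ≤ K) :
    ∃ ξ ∈ Ioo s (2 * s), ‖M (ξ • v)‖ ≤ 16 * ‖v‖ ^ 4 * K / c * s ^ 2 := by
  have hv0 : v ≠ 0 := by
    rintro rfl
    have := hv (3 / 2 * s) ⟨by linarith, by linarith⟩
    simp at this
    linarith
  have htv : ∀ t ∈ Icc s (2 * s), t • v ≠ 0 := fun t ht =>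
    smul_ne_zero (hs.trans_le ht.1).ne' hv0
  have hderiv : ∀ t ∈ Icc s (2 * s), HasDerivAt (fun t : ℝ => ⟪M (t • v), v⟫)
      ⟪fderiv ℝ M (t • v) v, v⟫ t := by
    intro t ht
    have h1 : HasDerivAt (fun t : ℝ => t • v) v t := by simpa using (hasDerivAt_id t).smul_const v
    have h2 := ((hMdiff _ (htv t ht)).hasFDerivAt.comp_hasDerivAt t h1).inner ℝ
      (hasDerivAt_const t v)
    simpa using h2
  obtain ⟨ξ, hξ, hslope⟩ := exists_hasDerivAt_eq_slope (fun t : ℝ => ⟪M (t • v), v⟫) _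
    (by linarith : s < 2 * s) (fun t ht => (hderiv t ht).continuousAt.continuousWithinAt)
    (fun t ht => hderiv t (Ioo_subset_Icc_self ht))
  refine ⟨ξ, hξ, ?_⟩
  have hξ0 : 0 < ξ := hs.trans hξ.1
  have hvn : 0 < ‖v‖ := norm_pos_iff.2 hv0
  have hg : ∀ t ∈ Icc s (2 * s), |⟪M (t • v), v⟫| ≤ K * ‖v‖ := fun t ht =>
    (abs_real_inner_le_norm _ _).trans (mul_le_mul_of_nonneg_right (hK t ht) hvn.le)
  have hosc := (abs_sub _ _).trans (add_le_add (hg (2 * s) ⟨by linarith, le_rfl⟩)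
    (hg s ⟨le_rfl, by linarith⟩))
  rw [fderiv_eq_smul_of_normalized hMne hG (htv ξ (Ioo_subset_Icc_self hξ)),
    smul_apply, real_inner_smul_left, norm_smul,
    Real.norm_of_nonneg hξ0.le, show 2 * s - s = s by ring] at hslope
  have h3 : ‖M (ξ • v)‖ / (ξ * ‖v‖) ^ 3 * c ≤ 2 * K * ‖v‖ / s := by
    calc _ ≤ ‖M (ξ • v)‖ / (ξ * ‖v‖) ^ 3 * |⟪G (ξ • v) v, v⟫| := by
          gcongr
          exact hv ξ hξ
      _ = |‖M (ξ • v)‖ / (ξ * ‖v‖) ^ 3 * ⟪G (ξ • v) v, v⟫| := by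
          rw [abs_mul, abs_of_nonneg (by positivity : 0 ≤ ‖M (ξ • v)‖ / (ξ * ‖v‖) ^ 3)]
      _ ≤ 2 * K * ‖v‖ / s := by
          rw [hslope, abs_div, abs_of_pos hs]
          gcongr
          linarith
  have hK0 : 0 ≤ K := (norm_nonneg _).trans (hK s ⟨le_rfl, by linarith⟩)
  have h4 : ‖M (ξ • v)‖ ≤ 2 * K * ‖v‖ / s * (ξ * ‖v‖) ^ 3 / c := by
    rw [le_div_iff₀ hc]
    rwa [div_mul_eq_mul_div, div_le_iff₀ (by positivity)] at h3
  refine h4.trans ?_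
  calc 2 * K * ‖v‖ / s * (ξ * ‖v‖) ^ 3 / c ≤ 2 * K * ‖v‖ / s * (2 * s * ‖v‖) ^ 3 / c := by
        gcongr
        exact hξ.2.le
    _ = 16 * ‖v‖ ^ 4 * K / c * s ^ 2 := by field_simp; ring

/-- If the normalized Jacobian at the origin has a nondegenerate direction, then a growth bound of
order `k` for the monotone operator `M` at the origin improves to order `k + 2`. -/
lemma norm_le_pow_add_two (hmono : ∀ p q : EN N, 0 ≤ ⟪M p - M q, p - q⟫)
    (hMdiff : ∀ p : EN N, p ≠ 0 → DifferentiableAt ℝ M p)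
    (hMne : ∀ p : EN N, p ≠ 0 → M p ≠ 0) (hGcont : Continuous G)
    (hG : ∀ p : EN N, p ≠ 0 → G p = (‖p‖ ^ 3 / ‖M p‖) • fderiv ℝ M p)
    {e : EN N} (he : ⟪G 0 e, e⟫ ≠ 0) {k : ℕ}
    (hk : ∃ B s₀ : ℝ, 0 ≤ B ∧ 0 < s₀ ∧ ∀ s, 0 < s → s < s₀ → ∀ p, ‖p‖ ≤ s → ‖M p‖ ≤ B * s ^ k) :
    ∃ B s₀ : ℝ, 0 ≤ B ∧ 0 < s₀ ∧
      ∀ s, 0 < s → s < s₀ → ∀ p, ‖p‖ ≤ s → ‖M p‖ ≤ B * s ^ (k + 2) := by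
  obtain ⟨B, s₀, hB, hs₀, hbd⟩ := hk
  obtain ⟨c, hc, hce⟩ : ∃ c, 0 < c ∧ c < |⟪G 0 e, e⟫| := exists_between (abs_pos.2 he)
  have hcont : Continuous fun z : EN N × EN N => |⟪G z.1 z.2, z.2⟫| := by fun_prop
  obtain ⟨η, hη, hηc⟩ := Metric.eventually_nhds_iff.1
    ((hcont.tendsto (0, e)).eventually (lt_mem_nhds hce))
  set δ : ℝ := η / 2 with hδ
  have hδ0 : 0 < δ := by positivity
  set R : ℝ := ‖e‖ + δ with hR
  have hR0 : 0 < R := by positivity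
  have hcone : ∀ p w : EN N, ‖p‖ < η → ‖w - e‖ ≤ δ → c ≤ |⟪G p w, w⟫| := fun p w hp hw =>
    (hηc (y := (p, w)) (by
      rw [Prod.dist_eq, max_lt_iff, dist_zero_right, dist_eq_norm]
      exact ⟨hp, hw.trans_lt (by linarith)⟩)).le
  refine ⟨16 * R ^ 4 * (B * (4 * R / δ) ^ k) / c * (2 / δ) ^ 2 * (4 * R / δ + 1),
    min s₀ η * δ / (4 * R), by positivity, by positivity, fun s hs hss p hp => ?_⟩
  set s' : ℝ := 2 * s / δ with hs'
  have hs'0 : 0 < s' := by positivity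
  have hs'R : 2 * s' * R = 4 * R / δ * s := by rw [hs']; ring
  have hsmall : 2 * s' * R < min s₀ η := by
    rw [hs'R]
    rw [lt_div_iff₀ (by positivity)] at hss
    rw [div_mul_eq_mul_div, div_lt_iff₀ hδ0]
    linarith
  obtain ⟨σ, hσ, hσe⟩ : ∃ σ : ℝ, |σ| = 1 ∧ 0 ≤ σ * ⟪M p, e⟫ := by
    rcases le_total 0 ⟪M p, e⟫ with h | h
    · exact ⟨1, by simp, by simpa using h⟩
    · exact ⟨-1, by simp, by simpa using h⟩
  have hσσ : σ * σ = 1 := by rw [← abs_mul_abs_self, hσ, one_mul]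
  set w : EN N := e + (σ * δ) • ‖M p‖⁻¹ • M p with hw
  set v : EN N := σ • w with hv
  have hwe : ‖w - e‖ ≤ δ := by
    rw [hw, add_sub_cancel_left, norm_smul, Real.norm_eq_abs, abs_mul, hσ, one_mul,
      abs_of_pos hδ0]
    exact mul_le_of_le_one_right hδ0.le (norm_inv_norm_smul_self_le _)
  have hvR : ‖v‖ ≤ R := by
    rw [hv, norm_smul, Real.norm_eq_abs, hσ, one_mul]
    linarith [norm_le_norm_add_norm_sub' w e, norm_sub_rev w e]
  have htv : ∀ t ∈ Icc s' (2 * s'), ‖t • v‖ ≤ 2 * s' * R := by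
    intro t ht
    rw [norm_smul, Real.norm_of_nonneg (hs'0.le.trans ht.1)]
    exact mul_le_mul ht.2 hvR (norm_nonneg _) (by positivity)
  obtain ⟨ξ, hξ, hMξ⟩ := exists_norm_le_on_segment hMdiff hMne hG (v := v)
    (K := B * (2 * s' * R) ^ k) hc hs'0
    (fun t ht => by
      have h := hcone (t • v) w (((htv t (Ioo_subset_Icc_self ht)).trans_lt hsmall).trans_le
        (min_le_right _ _)) hwe
      rwa [show ⟪G (t • v) v, v⟫ = ⟪G (t • v) w, w⟫ by
        conv_lhs => rw [hv, map_smul, real_inner_smul_left, real_inner_smul_right, ← mul_assoc,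
          hσσ, one_mul]])
    (fun t ht => hbd _ (by positivity) (hsmall.trans_le (min_le_left _ _)) _ (htv t ht))
  have hξ0 : 0 < ξ := hs'0.trans hξ.1
  have hin : (2 * s) * ‖M p‖ ≤ ⟪M p, ξ • v⟫ := by
    have h1 : ⟪M p, ξ • v⟫ = ξ * (σ * ⟪M p, e⟫ + δ * ‖M p‖) := by
      rw [hv, hw, real_inner_smul_right, real_inner_smul_right, inner_add_right,
        real_inner_smul_right, inner_inv_norm_smul_self]
      linear_combination ξ * δ * ‖M p‖ * hσσ
    have h2 : 2 * s = s' * δ := by rw [hs']; field_simp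
    rw [h1, h2, mul_assoc]
    exact mul_le_mul hξ.1.le (by linarith) (by positivity) hξ0.le
  have h5 := norm_le_of_monotone hmono hin
  have h6 := htv ξ (Ioo_subset_Icc_self hξ)
  have h7 : s * ‖M p‖ ≤ s * (‖M (ξ • v)‖ * (4 * R / δ + 1)) := by
    calc s * ‖M p‖ ≤ (2 * s - ‖p‖) * ‖M p‖ := by gcongr; linarith
      _ ≤ _ := h5
      _ ≤ ‖M (ξ • v)‖ * (4 * R / δ * s + s) := by
        gcongr
        exact h6.trans_eq hs'R
      _ = _ := by ring
  have h8 := le_of_mul_le_mul_left h7 hs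
  refine h8.trans ?_
  calc ‖M (ξ • v)‖ * (4 * R / δ + 1)
      ≤ 16 * ‖v‖ ^ 4 * (B * (2 * s' * R) ^ k) / c * s' ^ 2 * (4 * R / δ + 1) := by gcongr
    _ ≤ 16 * R ^ 4 * (B * (2 * s' * R) ^ k) / c * s' ^ 2 * (4 * R / δ + 1) := by gcongr
    _ = _ := by rw [hs'R, hs', pow_add, mul_pow]; ring

/-- A monotone operator whose normalized Jacobian is not skew at the origin is `C¹`. -/
lemma contDiff_one_of_inner_ne_zero (hmono : ∀ p q : EN N, 0 ≤ ⟪M p - M q, p - q⟫)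
    (hMdiff : ∀ p : EN N, p ≠ 0 → DifferentiableAt ℝ M p)
    (hMne : ∀ p : EN N, p ≠ 0 → M p ≠ 0) (hGcont : Continuous G)
    (hG : ∀ p : EN N, p ≠ 0 → G p = (‖p‖ ^ 3 / ‖M p‖) • fderiv ℝ M p)
    {e : EN N} (he : ⟪G 0 e, e⟫ ≠ 0) :
    ContDiff ℝ 1 M ∧ fderiv ℝ M 0 = 0 := by
  obtain ⟨B, s₀, hB, hs₀, hbd⟩ : ∃ B s₀ : ℝ, 0 ≤ B ∧ 0 < s₀ ∧
      ∀ s, 0 < s → s < s₀ → ∀ p, ‖p‖ ≤ s → ‖M p‖ ≤ B * s ^ 4 := by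
    obtain ⟨B, hB, hbd⟩ := exists_norm_le_of_monotone hmono hMdiff 1
    refine norm_le_pow_add_two hmono hMdiff hMne hGcont hG he (k := 2) ?_
    refine norm_le_pow_add_two hmono hMdiff hMne hGcont hG he (k := 0) ?_
    exact ⟨B, 1, hB, one_pos, fun s _ hs p hp => by simpa using hbd p (hp.trans hs.le)⟩
  have hM0 : M 0 = 0 := by
    have h1 : Tendsto (fun s : ℝ => B * s ^ 4) (𝓝[>] 0) (𝓝 0) := by
      have : Continuous fun s : ℝ => B * s ^ 4 := by fun_prop
      simpa using (this.tendsto 0).mono_left nhdsWithin_le_nhds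
    have h2 : ∀ᶠ s in 𝓝[>] (0 : ℝ), ‖M 0‖ ≤ B * s ^ 4 := by
      filter_upwards [Ioo_mem_nhdsGT hs₀] with s hs
      exact hbd s hs.1 hs.2 0 (by simpa using hs.1.le)
    exact norm_le_zero_iff.1 (ge_of_tendsto h1 h2)
  have hbd' : ∀ᶠ p in 𝓝 (0 : EN N), ‖M p‖ ≤ B * ‖p‖ ^ 4 := by
    filter_upwards [ball_mem_nhds (0 : EN N) hs₀] with p hp
    rcases eq_or_ne p 0 with rfl | hp0
    · simp [hM0]
    · exact hbd ‖p‖ (norm_pos_iff.2 hp0) (mem_ball_zero_iff.1 hp) p le_rfl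
  have hder0 : HasFDerivAt M (0 : EN N →L[ℝ] EN N) 0 := by
    refine Asymptotics.IsBigO.hasFDerivAt (n := 4) ?_ (by norm_num)
    refine Asymptotics.IsBigO.of_bound B ?_
    filter_upwards [hbd'] with p hp
    simpa using hp
  refine ⟨contDiff_one_iff_fderiv.2 ⟨fun p => ?_, continuous_iff_continuousAt.2 fun p => ?_⟩,
    hder0.fderiv⟩
  · rcases eq_or_ne p 0 with rfl | hp
    · exact hder0.differentiableAt
    · exact hMdiff p hp
  · rcases eq_or_ne p 0 with rfl | hp
    · rw [ContinuousAt, hder0.fderiv]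
      have hlim : Tendsto (fun p : EN N => B * ‖p‖ * ‖G p‖) (𝓝 0) (𝓝 0) := by
        have : Continuous fun p : EN N => B * ‖p‖ * ‖G p‖ := by fun_prop
        simpa using this.tendsto 0
      refine squeeze_zero_norm' ?_ hlim
      filter_upwards [hbd'] with p hp
      rcases eq_or_ne p 0 with rfl | hp0
      · simp [hder0.fderiv]
      rw [fderiv_eq_smul_of_normalized hMne hG hp0, norm_smul, Real.norm_of_nonneg (by positivity)]
      gcongr
      rw [div_le_iff₀ (by positivity)]
      linarith
    · have h1 : fderiv ℝ M =ᶠ[𝓝 p] fun p => (‖M p‖ / ‖p‖ ^ 3) • G p := by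
        filter_upwards [isOpen_ne.mem_nhds hp] with q hq
        exact fderiv_eq_smul_of_normalized hMne hG hq
      refine ContinuousAt.congr ?_ h1.symm
      exact ((hMdiff p hp).continuousAt.norm.div (continuous_norm.pow 3).continuousAt
        (pow_ne_zero 3 (norm_ne_zero_iff.2 hp))).smul hGcont.continuousAt

end Regularity

section Trace

variable {N : ℕ}

lemma exists_inner_ne_zero_of_trace_comp_ne_zero {A H : EN N →L[ℝ] EN N}
    (hH : (H : EN N →ₗ[ℝ] EN N).IsSymmetric)
    (h : LinearMap.trace ℝ (EN N) (A.comp H).toLinearMap ≠ 0) : ∃ e, ⟪A e, e⟫ ≠ 0 := by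
  by_contra! hA
  apply h
  have hn : Module.finrank ℝ (EN N) = N := finrank_euclideanSpace_fin
  rw [LinearMap.trace_eq_sum_inner _ (hH.eigenvectorBasis hn)]
  refine Finset.sum_eq_zero fun i _ => ?_
  have h1 : H (hH.eigenvectorBasis hn i) = hH.eigenvalues hn i • hH.eigenvectorBasis hn i :=
    hH.apply_eigenvectorBasis hn i
  rw [ContinuousLinearMap.coe_coe, ContinuousLinearMap.comp_apply, h1, map_smul,
    real_inner_smul_right, real_inner_comm, hA, mul_zero]

lemma continuous_trace_toLinearMap :
    Continuous fun T : EN N →L[ℝ] EN N => LinearMap.trace ℝ (EN N) T.toLinearMap :=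
  ((LinearMap.trace ℝ (EN N)) ∘ₗ (ContinuousLinearMap.coeLM ℝ)).continuous_of_finiteDimensional

lemma trace_toLinearMap_eq_sum (T : EN N →L[ℝ] EN N) :
    LinearMap.trace ℝ (EN N) T.toLinearMap = ∑ i, T (EuclideanSpace.single i 1) i := by
  rw [LinearMap.trace_eq_sum_inner _ (EuclideanSpace.basisFun (Fin N) ℝ)]
  simp [EuclideanSpace.inner_single_left]

lemma gradient_eq_toDual_symm_comp (φ : EN N → ℝ) :
    gradient φ = (InnerProductSpace.toDual ℝ (EN N)).symm ∘ fderiv ℝ φ := rfl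

lemma contDiff_gradient {φ : EN N → ℝ} (hφ : ContDiff ℝ 2 φ) : ContDiff ℝ 1 (gradient φ) := by
  rw [gradient_eq_toDual_symm_comp]
  exact (InnerProductSpace.toDual ℝ (EN N)).symm.contDiff.comp
    (hφ.fderiv_right (by norm_num))

lemma isSymmetric_fderiv_gradient {φ : EN N → ℝ} (hφ : ContDiff ℝ 2 φ) (x : EN N) :
    (fderiv ℝ (gradient φ) x : EN N →ₗ[ℝ] EN N).IsSymmetric := by
  have hd : DifferentiableAt ℝ (gradient φ) x :=
    (contDiff_gradient hφ).differentiable one_ne_zero x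
  have hd2 : DifferentiableAt ℝ (fderiv ℝ φ) x :=
    (hφ.fderiv_right (m := 1) (by norm_num)).differentiable one_ne_zero x
  have key : ∀ v w, ⟪fderiv ℝ (gradient φ) x v, w⟫ = fderiv ℝ (fderiv ℝ φ) x v w := by
    intro v w
    have h1 := ((hd.hasFDerivAt.inner ℝ (hasFDerivAt_const w x)).fderiv)
    have h2 := (hd2.hasFDerivAt.clm_apply (hasFDerivAt_const w x)).fderiv
    have h3 : (fun y => ⟪gradient φ y, w⟫) = fun y => fderiv ℝ φ y w :=
      funext fun y => inner_gradient_left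
    rw [h3, h2] at h1
    simpa using (DFunLike.congr_fun h1 v).symm
  intro v w
  have hs : IsSymmSndFDerivAt ℝ φ x := hφ.contDiffAt.isSymmSndFDerivAt (by simp)
  simp only [ContinuousLinearMap.coe_coe]
  rw [key, real_inner_comm, key]
  exact hs.eq v w

end Trace

section IntegrationByParts

variable {N : ℕ}

lemma integrable_of_bddOn_compact {F : EN N → ℝ} (hF : AEStronglyMeasurable F volume)
    {T : Set (EN N)} (hT : IsCompact T) (hsupp : Function.support F ⊆ T) {C : ℝ}
    (hC : ∀ x ∈ T, ‖F x‖ ≤ C) : Integrable F := by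
  rw [← integrableOn_iff_integrable_of_support_subset hsupp]
  exact Measure.integrableOn_of_bounded hT.measure_lt_top.ne hF
    ((ae_restrict_mem hT.measurableSet).mono fun x hx => hC x hx)

lemma integral_fderiv_mul_of_lipschitz {f g : EN N → ℝ} {C D : NNReal} (hf : LipschitzWith C f)
    (hg : LipschitzWith D g) (hgc : HasCompactSupport g) (v : EN N) :
    Integrable (fun x => fderiv ℝ g x v * f x) ∧ Integrable (fun x => g x * fderiv ℝ f x v) ∧
      ∫ x, fderiv ℝ g x v * f x = -∫ x, g x * fderiv ℝ f x v := by
  have hK : IsCompact (tsupport g) := hgc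
  obtain ⟨B, hB⟩ := hK.exists_bound_of_continuousOn hf.continuous.continuousOn
  obtain ⟨B', hB'⟩ := hK.exists_bound_of_continuousOn hg.continuous.continuousOn
  refine ⟨?_, ?_, ?_⟩
  · refine integrable_of_bddOn_compact (C := D * ‖v‖ * B)
      ((measurable_fderiv_apply_const ℝ g v).aestronglyMeasurable.mul
        hf.continuous.aestronglyMeasurable) hK (fun x hx => ?_) fun x hx => ?_
    · refine support_fderiv_subset ℝ (f := g) fun h0 => hx ?_
      simp [h0]
    · rw [norm_mul]
      gcongr
      · exact (ContinuousLinearMap.le_opNorm _ _).trans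
          (mul_le_mul_of_nonneg_right (norm_fderiv_le_of_lipschitz ℝ hg) (norm_nonneg _))
      · exact hB x hx
  · refine integrable_of_bddOn_compact (C := B' * (C * ‖v‖))
      (hg.continuous.aestronglyMeasurable.mul
        (measurable_fderiv_apply_const ℝ f v).aestronglyMeasurable) hK (fun x hx => ?_)
        fun x hx => ?_
    · exact subset_tsupport _ (left_ne_zero_of_mul hx)
    · rw [norm_mul]
      have h0 := (norm_nonneg _).trans (hB' x hx)
      gcongr
      · exact hB' x hx
      · exact (ContinuousLinearMap.le_opNorm _ _).trans
          (mul_le_mul_of_nonneg_right (norm_fderiv_le_of_lipschitz ℝ hf) (norm_nonneg _))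
  · have h := LipschitzWith.integral_lineDeriv_mul_eq (μ := volume) hf hg hgc v
    simp only [lineDeriv_neg, neg_mul, integral_neg] at h
    have h1 : ∫ x, fderiv ℝ g x v * f x = ∫ x, lineDeriv ℝ g x v * f x := by
      refine integral_congr_ae ?_
      filter_upwards [hg.ae_differentiableAt] with x hx
      rw [hx.lineDeriv_eq_fderiv]
    have h2 : ∫ x, g x * fderiv ℝ f x v = ∫ x, lineDeriv ℝ f x v * g x := by
      refine integral_congr_ae ?_
      filter_upwards [hf.ae_differentiableAt] with x hx
      rw [hx.lineDeriv_eq_fderiv, mul_comm]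
    rw [h1, h2, h, neg_neg]

/-- The divergence theorem for a Lipschitz field against a compactly supported Lipschitz
function. -/
lemma integral_fderiv_apply_eq_neg_trace {V : EN N → EN N} {ψ : EN N → ℝ} {C D : NNReal}
    (hV : LipschitzWith C V) (hψ : LipschitzWith D ψ) (hψc : HasCompactSupport ψ) :
    Integrable (fun x => fderiv ℝ ψ x (V x)) ∧
    Integrable (fun x => ψ x * LinearMap.trace ℝ (EN N) (fderiv ℝ V x).toLinearMap) ∧
    ∫ x, fderiv ℝ ψ x (V x) =
      -∫ x, ψ x * LinearMap.trace ℝ (EN N) (fderiv ℝ V x).toLinearMap := by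
  have hVi : ∀ i, LipschitzWith C fun x => V x i := fun i =>
    LipschitzWith.of_dist_le_mul fun x y => (by
      rw [Real.dist_eq, ← Real.norm_eq_abs, ← PiLp.sub_apply]
      exact (PiLp.norm_apply_le _ i).trans ((dist_eq_norm _ _).symm.trans_le
        (hV.dist_le_mul x y)))
  have key := fun i => integral_fderiv_mul_of_lipschitz (hVi i) hψ hψc (EuclideanSpace.single i 1)
  have e1 : (fun x => fderiv ℝ ψ x (V x)) =
      fun x => ∑ i, fderiv ℝ ψ x (EuclideanSpace.single i 1) * V x i := by
    funext x
    conv_lhs => rw [← (EuclideanSpace.basisFun (Fin N) ℝ).sum_repr (V x)]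
    simp [map_sum, mul_comm]
  have e2 : (fun x => ψ x * LinearMap.trace ℝ (EN N) (fderiv ℝ V x).toLinearMap) =ᵐ[volume]
      fun x => ∑ i, ψ x * fderiv ℝ (fun y => V y i) x (EuclideanSpace.single i 1) := by
    filter_upwards [hV.ae_differentiableAt] with x hx
    rw [trace_toLinearMap_eq_sum, Finset.mul_sum]
    refine Finset.sum_congr rfl fun i _ => ?_
    have h1 : HasFDerivAt (fun y => V y i)
        ((EuclideanSpace.proj (𝕜 := ℝ) i).comp (fderiv ℝ V x)) x :=
      (EuclideanSpace.proj (𝕜 := ℝ) i).hasFDerivAt.comp x hx.hasFDerivAt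
    rw [h1.fderiv]
    rfl
  refine ⟨?_, ?_, ?_⟩
  · rw [e1]
    exact integrable_finsetSum _ fun i _ => (key i).1
  · exact (integrable_finsetSum _ fun i _ => (key i).2.1).congr e2.symm
  · rw [e1, integral_congr_ae e2, integral_finsetSum _ fun i _ => (key i).1,
      integral_finsetSum _ fun i _ => (key i).2.1, ← Finset.sum_neg_distrib]
    exact Finset.sum_congr rfl fun i _ => (key i).2.2

end IntegrationByParts

section Comparison

variable {N : ℕ}

lemma exists_lipschitzWith_of_ball {f : EN N → ℝ} {x₀ : EN N} {r R : ℝ} {L : NNReal} (hr : 0 ≤ r)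
    (hrR : r < R) (hf : LipschitzOnWith L f (ball x₀ R))
    (h0 : ∀ y, r < dist y x₀ → f y = 0) : ∃ K, LipschitzWith K f := by
  have hR : 0 < R := hr.trans_lt hrR
  set S : ℝ := |f x₀| + L * r with hS
  have hS0 : 0 ≤ S := by positivity
  have hbd : ∀ y, |f y| ≤ S := by
    intro y
    rcases lt_or_ge r (dist y x₀) with h | h
    · rw [h0 y h, abs_zero]; exact hS0
    · have h1 := hf.dist_le_mul y (h.trans_lt hrR) x₀ (mem_ball_self hR)
      rw [Real.dist_eq] at h1
      have h2 : (L : ℝ) * dist y x₀ ≤ L * r := by gcongr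
      linarith [abs_sub_abs_le_abs_sub (f y) (f x₀)]
  have hout : ∀ x y, y ∉ ball x₀ R → |f x| ≤ S / (R - r) * dist x y := by
    intro x y hy
    rcases lt_or_ge r (dist x x₀) with h | h
    · rw [h0 x h, abs_zero]
      exact mul_nonneg (div_nonneg hS0 (sub_nonneg.2 hrR.le)) dist_nonneg
    · have h1 : R - r ≤ dist x y := by
        rw [mem_ball, not_lt] at hy
        linarith [dist_triangle_left y x₀ x]
      rw [div_mul_eq_mul_div, le_div_iff₀ (sub_pos.2 hrR)]
      exact mul_le_mul (hbd x) h1 (sub_nonneg.2 hrR.le) hS0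
  refine ⟨max L (S / (R - r)).toNNReal, LipschitzWith.of_dist_le_mul fun x y => ?_⟩
  have hmono1 : (L : ℝ) * dist x y ≤ (max L (S / (R - r)).toNNReal : NNReal) * dist x y := by
    gcongr; exact le_max_left _ _
  have hmono2 : S / (R - r) * dist x y ≤ (max L (S / (R - r)).toNNReal : NNReal) * dist x y := by
    refine mul_le_mul_of_nonneg_right ((Real.le_coe_toNNReal _).trans ?_) dist_nonneg
    exact_mod_cast le_max_right _ _
  by_cases hx : x ∈ ball x₀ R
  · by_cases hy : y ∈ ball x₀ R
    · exact (hf.dist_le_mul x hx y hy).trans hmono1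
    · rw [Real.dist_eq, h0 y (hrR.trans_le (by simpa using hy)), sub_zero]
      exact (hout x y hy).trans hmono2
  · rw [Real.dist_eq, h0 x (hrR.trans_le (by simpa using hx)), zero_sub, abs_neg]
    refine (hout y x hx).trans ?_
    rw [dist_comm y x]
    exact hmono2

/-- If `φ` strictly touches a Lipschitz weak solution `u` from above and the divergence of
`M(∇φ)` is nonpositive near the touching point, then this divergence vanishes there. -/
lemma ae_trace_eq_zero_of_touching {Ω : Set (EN N)} (hΩo : IsOpen Ω)
    (hΩb : Bornology.IsBounded Ω) {M : EN N → EN N}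
    (hmono : ∀ p q : EN N, 0 ≤ ⟪M p - M q, p - q⟫)
    (hMdiff : ∀ p : EN N, p ≠ 0 → DifferentiableAt ℝ M p)
    {u : EN N → ℝ} {L : NNReal} (hu : LipschitzOnWith L u Ω)
    (hweak : ∀ φ : EN N → ℝ, ContDiff ℝ (⊤ : ℕ∞) φ → HasCompactSupport φ → tsupport φ ⊆ Ω →
      (∫ x in Ω, ⟪M (gradient u x), gradient φ x⟫) = 0)
    {φ : EN N → ℝ} {x₀ : EN N} {R ε : ℝ} (hR : 0 < R) (hε : 0 < ε) (hball : ball x₀ R ⊆ Ω)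
    {D E : NNReal} (hφ : LipschitzOnWith D φ (ball x₀ R))
    (hφd : ∀ y ∈ ball x₀ R, DifferentiableAt ℝ φ y)
    (hV : LipschitzOnWith E (fun y => M (gradient φ y)) (ball x₀ R))
    (htouch : ∀ y ∈ ball x₀ R, u y - φ y ≤ u x₀ - φ x₀ - ε * dist y x₀ ^ 2)
    (htr : ∀ y ∈ ball x₀ R, LinearMap.trace ℝ (EN N)
      (fderiv ℝ (fun y => M (gradient φ y)) y).toLinearMap ≤ 0) :
    ∃ s, 0 < s ∧ s ≤ R ∧ ∀ᵐ y : EN N, y ∈ ball x₀ s → LinearMap.trace ℝ (EN N)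
      (fderiv ℝ (fun y => M (gradient φ y)) y).toLinearMap = 0 := by
  set r : ℝ := R / 2 with hr
  have hr0 : 0 < r := by positivity
  have hrR : r < R := by linarith
  set h : EN N → ℝ := fun y => u y - φ y - (u x₀ - φ x₀) + ε * r ^ 2 with hh
  have hhx₀ : h x₀ = ε * r ^ 2 := by simp [hh]
  set ψ : EN N → ℝ := fun y => if y ∈ ball x₀ R then max (h y) 0 else 0 with hψdef
  have hψin : ∀ y ∈ ball x₀ R, ψ y = max (h y) 0 := fun y hy => if_pos hy
  have hψnn : ∀ y, 0 ≤ ψ y := by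
    intro y
    rw [hψdef]
    dsimp only
    split_ifs
    · exact le_max_right _ _
    · exact le_rfl
  have hψ0 : ∀ y, r < dist y x₀ → ψ y = 0 := by
    intro y hy
    by_cases hyR : y ∈ ball x₀ R
    · rw [hψin y hyR, max_eq_right]
      have h1 := htouch y hyR
      have h2 : ε * r ^ 2 ≤ ε * dist y x₀ ^ 2 := by gcongr
      simp only [hh]
      linarith
    · exact if_neg hyR
  have hhLip : LipschitzOnWith (L + D) h (ball x₀ R) := by
    refine LipschitzOnWith.of_dist_le_mul fun x hx y hy => ?_
    have h1 := hu.dist_le_mul x (hball hx) y (hball hy)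
    have h2 := hφ.dist_le_mul x hx y hy
    rw [Real.dist_eq] at h1 h2 ⊢
    have h3 : h x - h y = (u x - u y) - (φ x - φ y) := by simp only [hh]; ring
    rw [h3, NNReal.coe_add, add_mul]
    exact (abs_sub _ _).trans (add_le_add h1 h2)
  have hψLipOn : LipschitzOnWith (L + D) ψ (ball x₀ R) := by
    refine LipschitzOnWith.of_dist_le_mul fun x hx y hy => ?_
    rw [hψin x hx, hψin y hy]
    refine le_trans ?_ (hhLip.dist_le_mul x hx y hy)
    rw [Real.dist_eq, Real.dist_eq]
    exact abs_max_sub_max_le_abs _ _ _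
  obtain ⟨K, hψ⟩ := exists_lipschitzWith_of_ball hr0.le hrR hψLipOn hψ0
  have hts : tsupport ψ ⊆ closedBall x₀ r := closure_minimal
    (fun y hy => le_of_not_gt fun hlt => hy (hψ0 y hlt)) isClosed_closedBall
  have hψc : HasCompactSupport ψ :=
    (isCompact_closedBall x₀ r).of_isClosed_subset (isClosed_tsupport ψ) hts
  have htsR : tsupport ψ ⊆ ball x₀ R := hts.trans (closedBall_subset_ball hrR)
  have hfd0 : ∀ y, y ∉ ball x₀ R → fderiv ℝ ψ y = 0 := fun y hy =>
    Function.notMem_support.1 fun hmem =>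
      hy (htsR (support_fderiv_subset ℝ hmem))
  obtain ⟨V, hVlip, hVeq⟩ := hV.extend_finite_dimension
  obtain ⟨hint1, hint2, hibp⟩ := integral_fderiv_apply_eq_neg_trace hVlip hψ hψc
  -- the weak equation tested with `ψ`
  have hudiff : ∀ᵐ x : EN N, x ∈ Ω → DifferentiableAt ℝ u x := by
    filter_upwards [hu.ae_differentiableWithinAt_of_mem (μ := volume)] with x hx hxΩ
    exact (hx hxΩ).differentiableAt (hΩo.mem_nhds hxΩ)
  obtain ⟨B, hB, hMB⟩ := exists_norm_le_of_monotone hmono hMdiff L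
  have hMm : Measurable M := measurable_of_continuousOn_compl_singleton 0 fun p hp =>
    (hMdiff p hp).continuousAt.continuousWithinAt
  have hWm : Measurable fun x => M (gradient u x) := by
    refine hMm.comp ?_
    rw [gradient_eq_toDual_symm_comp]
    exact (InnerProductSpace.toDual ℝ (EN N)).symm.continuous.measurable.comp
      (measurable_fderiv ℝ u)
  have hWb : ∀ x ∈ Ω, ‖M (gradient u x)‖ ≤ B := by
    intro x hx
    refine hMB _ ?_
    rw [gradient, LinearIsometryEquiv.norm_map]
    exact norm_fderiv_le_of_lipschitzOn ℝ (hΩo.mem_nhds hx) hu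
  have hzero := setIntegral_fderiv_lipschitz_eq_zero hΩo hΩb hWm.aestronglyMeasurable hWb
    (fun χ h1 h2 h3 => by
      rw [← hweak χ h1 h2 h3]
      simp [inner_gradient_right]) hψ hψc (htsR.trans hball)
  have hfin : IsFiniteMeasure ((volume : Measure (EN N)).restrict Ω) :=
    isFiniteMeasure_restrict.2 hΩb.measure_lt_top.ne
  have hintW : IntegrableOn (fun x => fderiv ℝ ψ x (M (gradient u x))) Ω := by
    refine Measure.integrableOn_of_bounded (M := K * B) hΩb.measure_lt_top.ne ?_ ?_
    · exact (ContinuousLinearMap.id ℝ (EN N →L[ℝ] ℝ)).aestronglyMeasurable_comp₂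
        (measurable_fderiv ℝ _).aestronglyMeasurable hWm.aestronglyMeasurable
    · filter_upwards [ae_restrict_mem hΩo.measurableSet] with x hx
      exact (ContinuousLinearMap.le_opNorm _ _).trans
        (mul_le_mul (norm_fderiv_le_of_lipschitz ℝ hψ) (hWb x hx) (norm_nonneg _) K.coe_nonneg)
  have hle : ∫ x in Ω, fderiv ℝ ψ x (V x) ≤ ∫ x in Ω, fderiv ℝ ψ x (M (gradient u x)) := by
    refine integral_mono_ae hint1.integrableOn hintW ?_
    filter_upwards [ae_restrict_of_ae hudiff, ae_restrict_mem hΩo.measurableSet] with x hxd hxΩ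
    by_cases hxR : x ∈ ball x₀ R
    · have hnhds : ball x₀ R ∈ 𝓝 x := isOpen_ball.mem_nhds hxR
      rcases le_or_gt (h x) 0 with hx0 | hx0
      · have hmin : IsLocalMin ψ x := .of_forall fun y => by
          rw [hψin x hxR, max_eq_right hx0]
          exact hψnn y
        simp [hmin.fderiv_eq_zero]
      · have hpos : ∀ᶠ y in 𝓝 x, 0 < h y :=
          (hhLip.continuousOn.continuousAt hnhds).eventually (lt_mem_nhds hx0)
        have heq : ψ =ᶠ[𝓝 x] h := by
          filter_upwards [hpos, hnhds] with y hy hyR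
          rw [hψin y hyR, max_eq_left hy.le]
        have hder : fderiv ℝ ψ x = fderiv ℝ u x - fderiv ℝ φ x := by
          rw [heq.fderiv_eq]
          exact ((((hxd hxΩ).hasFDerivAt.sub (hφd x hxR).hasFDerivAt).sub_const _).add_const
            _).fderiv
        have h1 := hmono (gradient u x) (gradient φ x)
        rw [← hVeq hxR, hder, ← sub_nonneg, ← map_sub, sub_apply, ← inner_gradient_left,
          ← inner_gradient_left, ← inner_sub_left, real_inner_comm]
        exact h1
    · simp [hfd0 x hxR]
  rw [hzero, setIntegral_eq_integral_of_forall_compl_eq_zero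
    (fun x hx => by rw [hfd0 x fun hb => hx (hball hb), zero_apply]), hibp] at hle
  have hVfd : ∀ y ∈ ball x₀ R, fderiv ℝ V y = fderiv ℝ (fun y => M (gradient φ y)) y :=
    fun y hy => Filter.EventuallyEq.fderiv_eq
      ((hVeq.eventuallyEq_of_mem (isOpen_ball.mem_nhds hy)).symm)
  have hnonneg : 0 ≤ fun x => -(ψ x * LinearMap.trace ℝ (EN N) (fderiv ℝ V x).toLinearMap) := by
    intro x
    simp only [Pi.zero_apply]
    by_cases hxR : x ∈ ball x₀ R
    · rw [hVfd x hxR]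
      exact neg_nonneg.2 (mul_nonpos_of_nonneg_of_nonpos (hψnn x) (htr x hxR))
    · simp [show ψ x = 0 from if_neg hxR]
  have hae : (fun x => -(ψ x * LinearMap.trace ℝ (EN N) (fderiv ℝ V x).toLinearMap))
      =ᵐ[volume] 0 := by
    refine (integral_eq_zero_iff_of_nonneg hnonneg hint2.neg).1 (le_antisymm ?_
      (integral_nonneg hnonneg))
    rwa [integral_neg]
  have hψx₀ : 0 < ψ x₀ := by
    rw [hψin x₀ (mem_ball_self hR), hhx₀]
    exact lt_max_of_lt_left (by positivity)
  obtain ⟨s, hs, hsψ⟩ := Metric.eventually_nhds_iff_ball.1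
    ((hψ.continuous.tendsto x₀).eventually (lt_mem_nhds hψx₀))
  refine ⟨min s R, lt_min hs hR, min_le_right _ _, ?_⟩
  filter_upwards [hae] with y hy hyb
  have h1 := hsψ y (ball_subset_ball (min_le_left _ _) hyb)
  rw [hVfd y (ball_subset_ball (min_le_right _ _) hyb)] at hy
  simpa [h1.ne'] using hy

end Comparison

section Viscosity

variable {N : ℕ} {M : EN N → EN N} {G : EN N → (EN N →L[ℝ] EN N)}

/-- Away from the degenerate directions of `G 0`, the operator `M` is of class `C¹`. -/
lemma contDiffAt_one_of_trace_ne_zero (hmono : ∀ p q : EN N, 0 ≤ ⟪M p - M q, p - q⟫)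
    (hMdiff : ∀ p : EN N, p ≠ 0 → DifferentiableAt ℝ M p)
    (hMne : ∀ p : EN N, p ≠ 0 → M p ≠ 0) (hGcont : Continuous G)
    (hG : ∀ p : EN N, p ≠ 0 → G p = (‖p‖ ^ 3 / ‖M p‖) • fderiv ℝ M p)
    {p : EN N} {H : EN N →L[ℝ] EN N} (hH : (H : EN N →ₗ[ℝ] EN N).IsSymmetric)
    (htr : LinearMap.trace ℝ (EN N) ((G p).comp H).toLinearMap ≠ 0) :
    ContDiffAt ℝ 1 M p ∧
      ∀ᶠ q in 𝓝 p, DifferentiableAt ℝ M q ∧ (q = 0 → fderiv ℝ M q = 0) := by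
  by_cases hp : p = 0
  · subst hp
    obtain ⟨e, he⟩ := exists_inner_ne_zero_of_trace_comp_ne_zero hH htr
    obtain ⟨h1, h2⟩ := contDiff_one_of_inner_ne_zero hmono hMdiff hMne hGcont hG he
    exact ⟨h1.contDiffAt, .of_forall fun q =>
      ⟨h1.differentiable one_ne_zero q, fun hq => hq ▸ h2⟩⟩
  · have hev : ∀ᶠ q in 𝓝 p, q ≠ 0 := eventually_ne_nhds hp
    refine ⟨?_, hev.mono fun q hq => ⟨hMdiff q hq, fun h => (hq h).elim⟩⟩
    refine contDiffAt_one_iff.2 ⟨fun q => (‖M q‖ / ‖q‖ ^ 3) • G q, {q | q ≠ 0}, hev, ?_, ?_⟩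
    · intro q hq
      have hM : ContinuousWithinAt M {q | q ≠ 0} q :=
        (hMdiff q hq).continuousAt.continuousWithinAt
      exact (hM.norm.div (continuous_norm.pow 3).continuousWithinAt
        (pow_ne_zero 3 (norm_ne_zero_iff.2 hq))).smul hGcont.continuousWithinAt
    · intro q hq
      beta_reduce
      rw [← fderiv_eq_smul_of_normalized hMne hG hq]
      exact (hMdiff q hq).hasFDerivAt

/-- A Lipschitz weak solution cannot be touched from above, strictly in the quadratic sense,
by a strict supersolution. -/
lemma not_trace_neg_of_touching {Ω : Set (EN N)} (hΩo : IsOpen Ω)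
    (hΩb : Bornology.IsBounded Ω) (hmono : ∀ p q : EN N, 0 ≤ ⟪M p - M q, p - q⟫)
    (hMdiff : ∀ p : EN N, p ≠ 0 → DifferentiableAt ℝ M p)
    (hMne : ∀ p : EN N, p ≠ 0 → M p ≠ 0) (hGcont : Continuous G)
    (hG : ∀ p : EN N, p ≠ 0 → G p = (‖p‖ ^ 3 / ‖M p‖) • fderiv ℝ M p)
    {u : EN N → ℝ} (hu : LipOn u Ω)
    (hweak : ∀ φ : EN N → ℝ, ContDiff ℝ (⊤ : ℕ∞) φ → HasCompactSupport φ → tsupport φ ⊆ Ω →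
      (∫ x in Ω, ⟪M (gradient u x), gradient φ x⟫) = 0)
    {φ : EN N → ℝ} (hφ : ContDiff ℝ 2 φ) {x₀ : EN N} (hx₀ : x₀ ∈ Ω) {ε : ℝ} (hε : 0 < ε)
    (htouch : ∀ᶠ y in 𝓝 x₀, u y - φ y ≤ u x₀ - φ x₀ - ε * dist y x₀ ^ 2) :
    0 ≤ LinearMap.trace ℝ (EN N)
      ((G (gradient φ x₀)).comp (fderiv ℝ (gradient φ) x₀)).toLinearMap := by
  by_contra! hneg
  obtain ⟨L, hL⟩ := hu
  have hgrad := contDiff_gradient hφ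
  obtain ⟨hM1, hMev⟩ := contDiffAt_one_of_trace_ne_zero hmono hMdiff hMne hGcont hG
    (isSymmetric_fderiv_gradient hφ x₀) hneg.ne
  obtain ⟨E, tV, htV, hV⟩ := (hM1.comp x₀ hgrad.contDiffAt).exists_lipschitzOnWith
  obtain ⟨D, tφ, htφ, hφL⟩ := (hφ.contDiffAt (x := x₀)).of_le one_le_two |>.exists_lipschitzOnWith
  have htrc : Continuous fun y => LinearMap.trace ℝ (EN N)
      ((G (gradient φ y)).comp (fderiv ℝ (gradient φ) y)).toLinearMap :=
    continuous_trace_toLinearMap.comp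
      ((hGcont.comp hgrad.continuous).clm_comp (hgrad.continuous_fderiv one_ne_zero))
  obtain ⟨R, hR, hRall⟩ := Metric.eventually_nhds_iff_ball.1
    (htouch.and <| (hΩo.eventually_mem hx₀).and <| (eventually_mem_set.2 htV).and <|
      (eventually_mem_set.2 htφ).and <|
      (hgrad.continuous.continuousAt.eventually hMev).and <|
      (htrc.tendsto x₀).eventually (gt_mem_nhds hneg))
  have hkey : ∀ y ∈ ball x₀ R, (gradient φ y = 0 ∧ LinearMap.trace ℝ (EN N)
      (fderiv ℝ (fun y => M (gradient φ y)) y).toLinearMap = 0) ∨ LinearMap.trace ℝ (EN N)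
      (fderiv ℝ (fun y => M (gradient φ y)) y).toLinearMap < 0 := by
    intro y hy
    obtain ⟨-, -, -, -, ⟨hMd, hM0⟩, hlt⟩ := hRall y hy
    have hcomp : fderiv ℝ (fun y => M (gradient φ y)) y =
        (fderiv ℝ M (gradient φ y)).comp (fderiv ℝ (gradient φ) y) :=
      fderiv_comp y hMd (hgrad.differentiable one_ne_zero y)
    rw [hcomp]
    by_cases h0 : gradient φ y = 0
    · left
      refine ⟨h0, ?_⟩
      rw [hM0 h0]
      simp
    · right
      rw [fderiv_eq_smul_of_normalized hMne hG h0, ContinuousLinearMap.smul_comp,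
        ContinuousLinearMap.toLinearMap_smul, map_smul, smul_eq_mul]
      exact mul_neg_of_pos_of_neg (div_pos (norm_pos_iff.2 (hMne _ h0))
        (pow_pos (norm_pos_iff.2 h0) 3)) hlt
  obtain ⟨s, hs, hsR, hae⟩ := ae_trace_eq_zero_of_touching hΩo hΩb hmono hMdiff hL hweak hR hε
    (fun y hy => (hRall y hy).2.1) (hφL.mono fun y hy => (hRall y hy).2.2.2.1)
    (fun y _ => hφ.differentiable two_ne_zero y)
    (hV.mono fun y hy => (hRall y hy).2.2.1) (fun y hy => (hRall y hy).1)
    (fun y hy => (hkey y hy).elim (fun h => h.2.le) le_of_lt)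
  have hnull : volume ({y | gradient φ y ≠ 0} ∩ ball x₀ s) = 0 := by
    refine measure_mono_null ?_ (ae_iff.1 hae)
    rintro y ⟨hy0, hys⟩ hy
    exact (hkey y (ball_subset_ball hsR hys)).elim (fun h => hy0 h.1) fun h => h.ne (hy hys)
  have hempty := ((isOpen_ne_fun hgrad.continuous continuous_const).inter
    isOpen_ball).eq_empty_of_measure_zero hnull
  have hloc : gradient φ =ᶠ[𝓝 x₀] fun _ => 0 := by
    filter_upwards [ball_mem_nhds x₀ hs] with y hy
    by_contra hy0
    exact eq_empty_iff_forall_notMem.1 hempty y ⟨hy0, hy⟩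
  rw [hloc.fderiv_eq] at hneg
  simp at hneg

/-- At a maximum point of `u - φ` the test function `φ` satisfies the viscosity inequality. -/
lemma trace_nonneg_of_isLocalMax {Ω : Set (EN N)} (hΩo : IsOpen Ω)
    (hΩb : Bornology.IsBounded Ω) (hmono : ∀ p q : EN N, 0 ≤ ⟪M p - M q, p - q⟫)
    (hMdiff : ∀ p : EN N, p ≠ 0 → DifferentiableAt ℝ M p)
    (hMne : ∀ p : EN N, p ≠ 0 → M p ≠ 0) (hGcont : Continuous G)
    (hG : ∀ p : EN N, p ≠ 0 → G p = (‖p‖ ^ 3 / ‖M p‖) • fderiv ℝ M p)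
    {u : EN N → ℝ} (hu : LipOn u Ω)
    (hweak : ∀ φ : EN N → ℝ, ContDiff ℝ (⊤ : ℕ∞) φ → HasCompactSupport φ → tsupport φ ⊆ Ω →
      (∫ x in Ω, ⟪M (gradient u x), gradient φ x⟫) = 0)
    {φ : EN N → ℝ} (hφ : ContDiff ℝ 2 φ) {x₀ : EN N} (hx₀ : x₀ ∈ Ω)
    (hmax : IsLocalMax (fun y => u y - φ y) x₀) :
    0 ≤ LinearMap.trace ℝ (EN N)
      ((G (gradient φ x₀)).comp (fderiv ℝ (gradient φ) x₀)).toLinearMap := by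
  have hgrad := contDiff_gradient hφ
  have hε : ∀ ε : ℝ, 0 < ε → 0 ≤ LinearMap.trace ℝ (EN N) ((G (gradient φ x₀)).comp
      (fderiv ℝ (gradient φ) x₀ + (2 * ε) • ContinuousLinearMap.id ℝ (EN N))).toLinearMap := by
    intro ε hε
    have hg : gradient (fun y => φ y + ε * ‖y - x₀‖ ^ 2) =
        fun y => gradient φ y + (2 * ε) • (y - x₀) := by
      funext y
      refine HasGradientAt.gradient ?_
      rw [hasGradientAt_iff_hasFDerivAt]
      have h1 := (hφ.differentiable two_ne_zero y).hasFDerivAt.add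
        ((((hasFDerivAt_id y).sub_const x₀).norm_sq).const_mul ε)
      refine h1.congr_fderiv ?_
      ext v
      simp
      ring
    have h := not_trace_neg_of_touching hΩo hΩb hmono hMdiff hMne hGcont hG hu hweak
      (φ := fun y => φ y + ε * ‖y - x₀‖ ^ 2) (hφ.add (contDiff_const.mul
        ((contDiff_id.sub contDiff_const).norm_sq ℝ))) hx₀ hε (by
        filter_upwards [hmax] with y hy
        simp only [dist_eq_norm, sub_self, norm_zero]
        linarith)
    have hf : fderiv ℝ (fun y => gradient φ y + (2 * ε) • (y - x₀)) x₀ =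
        fderiv ℝ (gradient φ) x₀ + (2 * ε) • ContinuousLinearMap.id ℝ (EN N) :=
      ((hgrad.differentiable one_ne_zero x₀).hasFDerivAt.add
        (((hasFDerivAt_id x₀).sub_const x₀).const_smul (2 * ε))).fderiv
    rw [hg, hf] at h
    simpa using h
  have hc : Continuous fun ε : ℝ => LinearMap.trace ℝ (EN N) ((G (gradient φ x₀)).comp
      (fderiv ℝ (gradient φ) x₀ + (2 * ε) • ContinuousLinearMap.id ℝ (EN N))).toLinearMap :=
    continuous_trace_toLinearMap.comp (by fun_prop)
  have hlim := (hc.tendsto 0).mono_left (nhdsWithin_le_nhds (s := Ioi 0))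
  simpa using ge_of_tendsto hlim (eventually_mem_nhdsWithin.mono fun ε hε' => hε ε hε')

end Viscosity

/-- A Lipschitz weak solution of `div(M(∇u)) = 0`, for a monotone operator `M`
whose normalized Jacobian `‖p‖³/‖M(p)‖·DM(p)` extends continuously to `ℝᴺ`, is a viscosity
solution of `−tr(G(∇u)·∇²u) = 0`. -/
theorem weakSolution_is_viscositySolution
    (N : ℕ) (Ω : Set (EN N)) (hΩo : IsOpen Ω) (hΩb : Bornology.IsBounded Ω)
    (M : EN N → EN N)
    (hmono : ∀ p q : EN N, 0 ≤ ⟪M p - M q, p - q⟫)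
    (hMdiff : ∀ p : EN N, p ≠ 0 → DifferentiableAt ℝ M p)
    (hMne : ∀ p : EN N, p ≠ 0 → M p ≠ 0)
    (G : EN N → (EN N →L[ℝ] EN N))
    (hGcont : Continuous G)
    (hG : ∀ p : EN N, p ≠ 0 → G p = (‖p‖ ^ 3 / ‖M p‖) • fderiv ℝ M p)
    (u : EN N → ℝ) (hLip : LipOn u Ω)
    (hweak : ∀ φ : EN N → ℝ, ContDiff ℝ (⊤ : ℕ∞) φ → HasCompactSupport φ → tsupport φ ⊆ Ω →
      (∫ x in Ω, ⟪M (gradient u x), gradient φ x⟫) = 0) :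
    ViscositySol Ω
      (fun p H => -(LinearMap.trace ℝ (EN N) ((G p).comp H).toLinearMap)) u := by
  obtain ⟨L, hL⟩ := hLip
  refine ⟨hL.continuousOn, fun x hx φ hφ hmax => ?_, fun x hx φ hφ hmin => ?_⟩
  · exact neg_nonpos.2 (trace_nonneg_of_isLocalMax hΩo hΩb hmono hMdiff hMne hGcont hG ⟨L, hL⟩
      hweak hφ hx (hmax.isLocalMax (hΩo.mem_nhds hx)))
  · have hneg : ∀ w : EN N → ℝ, gradient (fun y => -w y) = fun y => -gradient w y := fun w => by
      funext y
      simp [gradient, fderiv_fun_neg]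
    have hfM : ∀ p : EN N, p ≠ 0 → HasFDerivAt (fun q => -M (-q)) (fderiv ℝ M (-p)) p := by
      intro p hp
      have h := ((hMdiff (-p) (neg_ne_zero.2 hp)).hasFDerivAt.comp p (hasFDerivAt_id p).neg).neg
      refine h.congr_fderiv ?_
      ext v
      simp
    have h := trace_nonneg_of_isLocalMax (M := fun p => -M (-p)) (G := fun p => G (-p))
      (u := fun y => -u y) (φ := fun y => -φ y) hΩo hΩb
      (fun p q => by
        have h := hmono (-p) (-q)
        rw [← inner_neg_neg] at h
        convert h using 2 <;> abel)
      (fun p hp => (hfM p hp).differentiableAt)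
      (fun p hp => neg_ne_zero.2 (hMne _ (neg_ne_zero.2 hp))) (hGcont.comp continuous_neg)
      (fun p hp => by
        rw [(hfM p hp).fderiv, hG _ (neg_ne_zero.2 hp), norm_neg, norm_neg])
      ⟨L, hL.neg⟩
      (fun χ h1 h2 h3 => by
        simp only [hneg, neg_neg, inner_neg_left, integral_neg, hweak χ h1 h2 h3, neg_zero])
      hφ.neg hx (by
        have h := (hmin.isLocalMin (hΩo.mem_nhds hx)).neg
        refine h.congr (.of_forall fun y => ?_)
        ring)
    simp only [hneg, neg_neg] at h
    rw [show fderiv ℝ (fun y => -gradient φ y) x = -fderiv ℝ (gradient φ) x from fderiv_fun_neg,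
      ContinuousLinearMap.comp_neg, ContinuousLinearMap.toLinearMap_neg, map_neg] at h
    exact h
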